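/- Let 𝒳 be a finite set, μ : 𝒳 → (0,1] a probability measure, and C : 𝒳×𝒳 → [0,∞) symmetric. For a probability measure ω on 𝒳 and a finite symmetric measure ϖ on 𝒳×𝒳, define Î₃(ω,ϖ) = sup over functions f : 𝒳 → ℝ and symmetric functions g : 𝒳×𝒳 → ℝ of [ Σ_{a∈𝒳} (f(a) − Z(f))·ω(a) + (1/2)·Σ_{a,b∈𝒳} g(a,b)·ϖ(a,b) + (1/2)·Σ_{a,b∈𝒳} (1 − e^{g(a,b)})·C(a,b)·ω(a)·ω(b) ], where Z(f) = Σ_{a∈𝒳} f(a)·μ(a). Then Î₃(ω,ϖ) = (1/2)·𝔥_C(ϖ‖ω) if ω = μ, and Î₃(ω,ϖ) = +∞ otherwise. -/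

import Mathlib

open Filter
open scoped ENNReal

noncomputable section

namespace CRG

variable {𝒳 : Type} [Fintype 𝒳] [DecidableEq 𝒳]

/-- The set `ℰ` of formally ordered potential edges on `{1,…,n}`. -/
abbrev Edges (n : ℕ) : Finset (Fin n × Fin n) :=
  Finset.univ.filter (fun e : Fin n × Fin n => e.1 < e.2)

/-- The probability weight `P_n(x)` of a coloured graph `x` (colouring, edge set) under the
coloured random graph law with colour law `μ` and connection probabilities `p`. -/
def graphWeight (μ : 𝒳 → ℝ) (p : 𝒳 → 𝒳 → ℝ) (n : ℕ)
    (x : (Fin n → 𝒳) × Finset (Fin n × Fin n)) : ℝ :=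
  (if x.2 ⊆ Edges n then 1 else 0) *
  (∏ v, μ (x.1 v)) *
  ∏ e ∈ Edges n, (if e ∈ x.2 then p (x.1 e.1) (x.1 e.2) else 1 - p (x.1 e.1) (x.1 e.2))

/-- The probability `ℙ_n(S)` of an event `S` under the coloured random graph law. -/
def graphPr (μ : 𝒳 → ℝ) (p : 𝒳 → 𝒳 → ℝ) (n : ℕ)
    (S : Set ((Fin n → 𝒳) × Finset (Fin n × Fin n))) : ℝ :=
  ∑ x, S.indicator (graphWeight μ p n) x

/-- The empirical colour measure `L¹`. -/
def L1 (n : ℕ) (x : (Fin n → 𝒳) × Finset (Fin n × Fin n)) (a : 𝒳) : ℝ :=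
  ((Finset.univ.filter (fun v : Fin n => x.1 v = a)).card : ℝ) / n

/-- The empirical pair measure `L²` (scaled by `1/(n² aₙ)`). -/
def L2 (an : ℝ) (n : ℕ) (x : (Fin n → 𝒳) × Finset (Fin n × Fin n)) (q : 𝒳 × 𝒳) : ℝ :=
  (∑ e ∈ x.2, ((if (x.1 e.1, x.1 e.2) = q then (1:ℝ) else 0)
    + (if (x.1 e.2, x.1 e.1) = q then (1:ℝ) else 0))) / ((n:ℝ)^2 * an)

/-- Extended-real logarithm, `log 0 = -∞`. -/
def elog (x : ℝ) : EReal := if x ≤ 0 then ⊥ else ((Real.log x : ℝ) : EReal)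

/-- `ℳ(𝒳) × ℳ̃_*(𝒳×𝒳)`: probability vectors paired with finite symmetric measures,
viewed inside `ℝ^𝒳 × ℝ^(𝒳×𝒳)`. -/
def MSpace (𝒳 : Type) [Fintype 𝒳] : Set ((𝒳 → ℝ) × (𝒳 × 𝒳 → ℝ)) :=
  {z | (∀ a, 0 ≤ z.1 a) ∧ (∑ a, z.1 a) = 1 ∧ (∀ q, 0 ≤ z.2 q) ∧ ∀ a b, z.2 (a,b) = z.2 (b,a)}

open Classical in
/-- Relative entropy `H(ν‖ρ)` of measures on a finite set, `+∞` if `ν` is not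
absolutely continuous w.r.t. `ρ`. -/
def relEnt (ν ρ : 𝒳 → ℝ) : ℝ≥0∞ :=
  if ∀ x, ρ x = 0 → ν x = 0 then
    ENNReal.ofReal (∑ x, ν x * Real.log (ν x / ρ x)) else ⊤

open Classical in
/-- `𝔥_C(ϖ‖ω) = H(ϖ‖Cω⊗ω) + ‖Cω⊗ω‖ − ‖ϖ‖`. -/
def hRel (C : 𝒳 → 𝒳 → ℝ) (ω : 𝒳 → ℝ) (ϖ : 𝒳 × 𝒳 → ℝ) : ℝ≥0∞ :=
  if ∀ q : 𝒳 × 𝒳, C q.1 q.2 * ω q.1 * ω q.2 = 0 → ϖ q = 0 then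
    ENNReal.ofReal ((∑ q : 𝒳 × 𝒳, ϖ q * Real.log (ϖ q / (C q.1 q.2 * ω q.1 * ω q.2)))
      + (∑ q : 𝒳 × 𝒳, C q.1 q.2 * ω q.1 * ω q.2) - ∑ q : 𝒳 × 𝒳, ϖ q)
  else ⊤

end CRG

open CRG

/-- The variational functional `Î₃(ω,ϖ)` of Lemma 3.12: supremum over `f : 𝒳 → ℝ` and
symmetric `g : 𝒳×𝒳 → ℝ`, with `Z(f) = Σ_a f(a) μ(a)`. -/
def Ihat3 {𝒳 : Type} [Fintype 𝒳] (μ : 𝒳 → ℝ) (C : 𝒳 → 𝒳 → ℝ)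
    (ω : 𝒳 → ℝ) (ϖ : 𝒳 × 𝒳 → ℝ) : EReal :=
  ⨆ (f : 𝒳 → ℝ), ⨆ (g : 𝒳 × 𝒳 → ℝ), ⨆ (_ : ∀ i j, g (i,j) = g (j,i)),
    ((∑ i, (f i - ∑ j, f j * μ j) * ω i
      + (1/2) * ∑ q : 𝒳 × 𝒳, g q * ϖ q
      + (1/2) * ∑ q : 𝒳 × 𝒳, (1 - Real.exp (g q)) * (C q.1 q.2 * ω q.1 * ω q.2) : ℝ) : EReal)

namespace CRG

/-- Fenchel–Young inequality for the Poisson rate function. -/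
lemma mul_add_one_sub_exp_mul_le {p c : ℝ} (hp : 0 ≤ p) (hc : 0 ≤ c) (hpc : c = 0 → p = 0)
    (x : ℝ) : x * p + (1 - Real.exp x) * c ≤ p * Real.log (p / c) + c - p := by
  rcases hp.eq_or_lt with rfl | hp
  · have := mul_nonneg (Real.exp_pos x).le hc
    simp only [mul_zero, zero_mul]
    linarith
  have hc : 0 < c := hc.lt_of_ne fun h => hp.ne' (hpc h.symm)
  have h := Real.log_le_sub_one_of_pos (show 0 < c * Real.exp x / p by positivity)
  rw [Real.log_div (by positivity) hp.ne', Real.log_mul hc.ne' (Real.exp_ne_zero x),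
    Real.log_exp] at h
  have h' := mul_le_mul_of_nonneg_left h hp.le
  have hcancel : p * (c * Real.exp x / p - 1) = c * Real.exp x - p := by field_simp
  rw [hcancel] at h'
  rw [Real.log_div hp.ne' hc.ne']
  linarith

/-- A sequence attaining equality in `mul_add_one_sub_exp_mul_le` in the limit. -/
lemma tendsto_mul_add_one_sub_exp_mul {p c : ℝ} (hp : 0 ≤ p) (hc : 0 ≤ c)
    (hpc : c = 0 → p = 0) :
    Tendsto (fun n : ℕ =>
        (if p = 0 then -(n : ℝ) else Real.log (p / c)) * p +
          (1 - Real.exp (if p = 0 then -(n : ℝ) else Real.log (p / c))) * c)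
      atTop (nhds (p * Real.log (p / c) + c - p)) := by
  by_cases h : p = 0
  · have hexp : Tendsto (fun n : ℕ => Real.exp (-(n : ℝ))) atTop (nhds 0) :=
      Real.tendsto_exp_neg_atTop_nhds_zero.comp tendsto_natCast_atTop_atTop
    simpa [h] using (hexp.const_sub 1).mul_const c
  · have hp : 0 < p := hp.lt_of_ne (Ne.symm h)
    have hc : 0 < c := hc.lt_of_ne fun h' => h (hpc h'.symm)
    simp only [h, if_false, Real.exp_log (div_pos hp hc)]
    refine tendsto_const_nhds.congr fun _ => ?_
    field_simp
    ring

section Ihat3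

variable {𝒳 : Type} [Fintype 𝒳]

lemma sum_sub_sum_mul_mul (μ ω f : 𝒳 → ℝ) (hωs : ∑ a, ω a = 1) :
    ∑ i, (f i - ∑ j, f j * μ j) * ω i = ∑ i, f i * (ω i - μ i) := by
  simp only [sub_mul, mul_sub, Finset.sum_sub_distrib, ← Finset.mul_sum, hωs, mul_one]

lemma le_Ihat3 (μ : 𝒳 → ℝ) (C : 𝒳 → 𝒳 → ℝ) (ω : 𝒳 → ℝ) (ϖ : 𝒳 × 𝒳 → ℝ) (f : 𝒳 → ℝ)
    (g : 𝒳 × 𝒳 → ℝ) (hg : ∀ i j, g (i, j) = g (j, i)) :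
    ((∑ i, (f i - ∑ j, f j * μ j) * ω i
      + (1/2) * ∑ q : 𝒳 × 𝒳, g q * ϖ q
      + (1/2) * ∑ q : 𝒳 × 𝒳, (1 - Real.exp (g q)) * (C q.1 q.2 * ω q.1 * ω q.2) : ℝ) : EReal)
      ≤ Ihat3 μ C ω ϖ :=
  le_iSup_of_le f (le_iSup_of_le g (le_iSup_of_le hg le_rfl))

lemma Ihat3_eq_top_of_ne [DecidableEq 𝒳] {μ : 𝒳 → ℝ} {C : 𝒳 → 𝒳 → ℝ} {ω : 𝒳 → ℝ}
    {ϖ : 𝒳 × 𝒳 → ℝ} (hωs : ∑ a, ω a = 1) (hne : ω ≠ μ) : Ihat3 μ C ω ϖ = ⊤ := by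
  obtain ⟨a, ha⟩ := Function.ne_iff.mp hne
  have ha : ω a - μ a ≠ 0 := sub_ne_zero.mpr ha
  refine (EReal.eq_top_iff_forall_lt _).mpr fun M => ?_
  refine lt_of_lt_of_le ?_
    (le_Ihat3 μ C ω ϖ (Pi.single a ((M + 1) / (ω a - μ a))) 0 fun _ _ => rfl)
  rw [EReal.coe_lt_coe_iff, sum_sub_sum_mul_mul μ ω _ hωs]
  simp [Pi.single_apply, div_mul_cancel₀ _ ha]

lemma Ihat3_eq_top_of_not_abs_cont {μ : 𝒳 → ℝ} {C : 𝒳 → 𝒳 → ℝ} {ω : 𝒳 → ℝ}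
    {ϖ : 𝒳 × 𝒳 → ℝ} (hCsymm : ∀ a b, C a b = C b a) (hϖ0 : ∀ q, 0 ≤ ϖ q) {q₀ : 𝒳 × 𝒳}
    (hC : C q₀.1 q₀.2 * ω q₀.1 * ω q₀.2 = 0) (hϖ : ϖ q₀ ≠ 0) : Ihat3 μ C ω ϖ = ⊤ := by
  classical
  have hpos : 0 < ϖ q₀ := (hϖ0 q₀).lt_of_ne hϖ.symm
  refine (EReal.eq_top_iff_forall_lt _).mpr fun M => ?_
  set t : ℝ := 2 * (|M| + 1) / ϖ q₀ with ht
  have ht0 : 0 ≤ t := by positivity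
  let g : 𝒳 × 𝒳 → ℝ := fun q => if C q.1 q.2 * ω q.1 * ω q.2 = 0 then t else 0
  have hg : ∀ i j, g (i, j) = g (j, i) := fun i j => by
    simp only [g, hCsymm i j, mul_right_comm]
  have hexp : ∑ q : 𝒳 × 𝒳, (1 - Real.exp (g q)) * (C q.1 q.2 * ω q.1 * ω q.2) = 0 := by
    refine Finset.sum_eq_zero fun q _ => ?_
    by_cases h : C q.1 q.2 * ω q.1 * ω q.2 = 0
    · rw [h, mul_zero]
    · simp only [g, if_neg h, Real.exp_zero, sub_self, zero_mul]
  have hlin : t * ϖ q₀ ≤ ∑ q, g q * ϖ q := by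
    have hg0 : ∀ q, 0 ≤ g q := fun q => by
      simp only [g]
      split_ifs
      exacts [ht0, le_rfl]
    have := Finset.single_le_sum (f := fun q => g q * ϖ q)
      (fun q _ => mul_nonneg (hg0 q) (hϖ0 q)) (Finset.mem_univ q₀)
    rwa [show g q₀ = t from if_pos hC] at this
  refine lt_of_lt_of_le ?_ (le_Ihat3 μ C ω ϖ 0 g hg)
  rw [EReal.coe_lt_coe_iff, hexp]
  rw [ht, div_mul_cancel₀ _ hϖ] at hlin
  have := le_abs_self M
  simp only [Pi.zero_apply, zero_mul, Finset.sum_const_zero, sub_zero]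
  linarith

lemma Ihat3_self {μ : 𝒳 → ℝ} {C : 𝒳 → 𝒳 → ℝ} {ϖ : 𝒳 × 𝒳 → ℝ} (hμ0 : ∀ a, 0 ≤ μ a)
    (hμs : ∑ a, μ a = 1) (hC0 : ∀ a b, 0 ≤ C a b) (hCsymm : ∀ a b, C a b = C b a)
    (hϖ0 : ∀ q, 0 ≤ ϖ q) (hϖsymm : ∀ i j, ϖ (i, j) = ϖ (j, i))
    (hac : ∀ q : 𝒳 × 𝒳, C q.1 q.2 * μ q.1 * μ q.2 = 0 → ϖ q = 0) :
    Ihat3 μ C μ ϖ = ((1 / 2 * ∑ q : 𝒳 × 𝒳, (ϖ q * Real.log (ϖ q / (C q.1 q.2 * μ q.1 * μ q.2))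
      + C q.1 q.2 * μ q.1 * μ q.2 - ϖ q) : ℝ) : EReal) := by
  classical
  have hc : ∀ q : 𝒳 × 𝒳, 0 ≤ C q.1 q.2 * μ q.1 * μ q.2 := fun q =>
    mul_nonneg (mul_nonneg (hC0 _ _) (hμ0 _)) (hμ0 _)
  have hval : ∀ f : 𝒳 → ℝ, ∀ g : 𝒳 × 𝒳 → ℝ,
      ∑ i, (f i - ∑ j, f j * μ j) * μ i + (1/2) * ∑ q : 𝒳 × 𝒳, g q * ϖ q
        + (1/2) * ∑ q : 𝒳 × 𝒳, (1 - Real.exp (g q)) * (C q.1 q.2 * μ q.1 * μ q.2)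
      = 1 / 2 * ∑ q : 𝒳 × 𝒳, (g q * ϖ q
        + (1 - Real.exp (g q)) * (C q.1 q.2 * μ q.1 * μ q.2)) := fun f g => by
    rw [sum_sub_sum_mul_mul μ μ f hμs, Finset.sum_add_distrib]
    simp only [sub_self, mul_zero, Finset.sum_const_zero]
    ring
  apply le_antisymm
  · refine iSup_le fun f => iSup_le fun g => iSup_le fun _ => ?_
    rw [hval, EReal.coe_le_coe_iff]
    gcongr with q
    exact mul_add_one_sub_exp_mul_le (hϖ0 q) (hc q) (hac q) (g q)
  · let g : ℕ → 𝒳 × 𝒳 → ℝ := fun n q =>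
      if ϖ q = 0 then -(n : ℝ) else Real.log (ϖ q / (C q.1 q.2 * μ q.1 * μ q.2))
    have hg : ∀ n i j, g n (i, j) = g n (j, i) := fun n i j => by
      simp only [g, hϖsymm i j, hCsymm i j, mul_right_comm]
    have hlim := (tendsto_finsetSum Finset.univ fun (q : 𝒳 × 𝒳) _ =>
      tendsto_mul_add_one_sub_exp_mul (hϖ0 q) (hc q) (hac q)).const_mul (1 / 2)
    refine le_of_tendsto' ((continuous_coe_real_ereal.tendsto _).comp hlim) fun n => ?_
    have := le_Ihat3 μ C μ ϖ 0 (g n) (hg n)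
    rwa [hval] at this

end Ihat3

end CRG

open Classical in
/-- **Solution of the variational problem for `Î₃`** (Lemma 3.13):
`Î₃(ω,ϖ) = ½ 𝔥_C(ϖ‖ω)` if `ω = μ`, and `Î₃(ω,ϖ) = +∞` otherwise. -/
theorem variational_Ihat3
    {𝒳 : Type} [Fintype 𝒳] [DecidableEq 𝒳] [Nonempty 𝒳]
    (μ : 𝒳 → ℝ) (hμ0 : ∀ a, 0 < μ a) (hμ1 : ∀ a, μ a ≤ 1) (hμs : ∑ a, μ a = 1)
    (C : 𝒳 → 𝒳 → ℝ) (hC0 : ∀ a b, 0 ≤ C a b) (hCsymm : ∀ a b, C a b = C b a)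
    (ω : 𝒳 → ℝ) (hω0 : ∀ a, 0 ≤ ω a) (hωs : ∑ a, ω a = 1)
    (ϖ : 𝒳 × 𝒳 → ℝ) (hϖ0 : ∀ q, 0 ≤ ϖ q) (hϖsymm : ∀ i j, ϖ (i,j) = ϖ (j,i)) :
    Ihat3 μ C ω ϖ =
      if ω = μ then (((1:ℝ)/2 : ℝ) : EReal) * ((hRel C ω ϖ : ℝ≥0∞) : EReal) else ⊤ := by
  split_ifs with hω
  · subst hω
    by_cases hac : ∀ q : 𝒳 × 𝒳, C q.1 q.2 * ω q.1 * ω q.2 = 0 → ϖ q = 0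
    · have hnonneg : 0 ≤ ∑ q : 𝒳 × 𝒳, (ϖ q * Real.log (ϖ q / (C q.1 q.2 * ω q.1 * ω q.2))
          + C q.1 q.2 * ω q.1 * ω q.2 - ϖ q) :=
        Finset.sum_nonneg fun q _ => by
          simpa using mul_add_one_sub_exp_mul_le (hϖ0 q)
            (mul_nonneg (mul_nonneg (hC0 _ _) (hω0 _)) (hω0 _)) (hac q) 0
      rw [Ihat3_self hω0 hωs hC0 hCsymm hϖ0 hϖsymm hac, hRel, if_pos hac,
        ← Finset.sum_add_distrib, ← Finset.sum_sub_distrib, EReal.coe_ennreal_ofReal,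
        max_eq_left hnonneg, EReal.coe_mul]
    · rw [hRel, if_neg hac, EReal.coe_ennreal_top, EReal.coe_mul_top_of_pos (by norm_num)]
      push Not at hac
      obtain ⟨q, hq, hϖq⟩ := hac
      exact Ihat3_eq_top_of_not_abs_cont hCsymm hϖ0 hq hϖq
  · exact Ihat3_eq_top_of_ne hωs hω
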